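/- Let τ = τ_F and consider the d-multiple Walsh series with coefficients a_𝐧 = τ̂_𝐧 (the Fourier–Walsh coefficients of τ). Then a_𝟎 = 1, so not all coefficients vanish, and for every 𝐠 ∈ 𝔾^d ∖ F this series converges to 0 over rectangles; consequently it also converges to 0 over cubes and iteratedly for every order of iterated summation at every such 𝐠. Hence the set F is an M-set for the d-dimensional Walsh system under rectangular convergence, convergence over cubes, and iterated convergence in any order. -/

import Mathlib

open Filter Finset Topology MeasureTheory
open scoped Classical

noncomputable section

instance : TopologicalSpace (ZMod 2) := ⊥
instance : DiscreteTopology (ZMod 2) := ⟨rfl⟩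

/-- The dyadic (Cantor) group `𝔾`: sequences of elements of `ℤ/2ℤ`
with coordinatewise addition modulo 2, Tychonoff topology. -/
abbrev DyadicGroup : Type := ℕ → ZMod 2

instance : MeasurableSpace DyadicGroup := borel _
instance : BorelSpace DyadicGroup := ⟨rfl⟩

/-- `𝔾^d`. -/
abbrev GD (d : ℕ) : Type := Fin d → DyadicGroup

/-- One-dimensional Walsh function `W_n` in the Paley enumeration:
`W_n(g) = ∏_k (-1)^(g_k n_k)`. -/
def walsh (n : ℕ) (g : DyadicGroup) : ℝ :=
  ∏ k ∈ Finset.range n, if n.testBit k ∧ g k = 1 then (-1 : ℝ) else 1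

/-- `d`-dimensional Walsh function `W_𝐧(𝐠) = ∏ W_{n^l}(g^l)`. -/
def walshD {d : ℕ} (n : Fin d → ℕ) (g : GD d) : ℝ :=
  ∏ l, walsh (n l) (g l)

/-- The dyadic interval `Δ^{(k)}_m` of rank `k`. -/
def dyadicInterval (k m : ℕ) : Set DyadicGroup :=
  {g | ∀ t < k, g t = if m.testBit (k - 1 - t) then 1 else 0}

/-- The dyadic cube `Δ^{(k)}_𝐦 = Δ^{(k)}_{m^1} × ⋯ × Δ^{(k)}_{m^d}`. -/
def dyadicCube {d : ℕ} (k : ℕ) (m : Fin d → ℕ) : Set (GD d) :=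
  {g | ∀ l, g l ∈ dyadicInterval k (m l)}

/-- The canonical point of `Δ^{(k)}_m`. -/
def intervalPoint (k m : ℕ) : DyadicGroup :=
  fun t => if t < k ∧ m.testBit (k - 1 - t) then 1 else 0

/-- The canonical point of `Δ^{(k)}_𝐦`. -/
def cubePoint {d : ℕ} (k : ℕ) (m : Fin d → ℕ) : GD d :=
  fun l => intervalPoint k (m l)

/-- `W^{(k)}_{n,m}`: the (constant, for `n < 2^k`) value of `W_n` on `Δ^{(k)}_m`. -/
def walshVal (k n m : ℕ) : ℝ := walsh n (intervalPoint k m)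

/-- `W^{(k)}_{𝐧𝐦}`: the (constant, for `𝐧 < 2^k·𝟏`) value of `W_𝐧` on `Δ^{(k)}_𝐦`. -/
def walshValD {d : ℕ} (k : ℕ) (n m : Fin d → ℕ) : ℝ := walshD n (cubePoint k m)

/-- The box `{𝐧 : 𝐧 < 𝐍}` as a finset. -/
def boxLt {d : ℕ} (N : Fin d → ℕ) : Finset (Fin d → ℕ) :=
  Fintype.piFinset fun l => Finset.range (N l)

/-- The box `{0,…,2^k−1}^d` as a set. -/
def box (d k : ℕ) : Set (Fin d → ℕ) := {m | ∀ l, m l < 2 ^ k}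

/-- The rectangular partial sum `S_𝐍(𝐠)` of the Walsh series with coefficients `a`. -/
def walshPartialSum {d : ℕ} (a : (Fin d → ℕ) → ℂ) (N : Fin d → ℕ) (g : GD d) : ℂ :=
  ∑ n ∈ boxLt N, a n * (walshD n g : ℂ)

/-- Convergence over rectangles: `S_𝐍(𝐠) → S` as `min_j N^j → ∞`. -/
def ConvergesOverRectangles {d : ℕ} (a : (Fin d → ℕ) → ℂ) (g : GD d) (S : ℂ) : Prop :=
  Tendsto (fun N : Fin d → ℕ => walshPartialSum a N g) atTop (𝓝 S)

/-- Convergence over cubes: `S_{N𝟏}(𝐠) → S` as `N → ∞`. -/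
def ConvergesOverCubes {d : ℕ} (a : (Fin d → ℕ) → ℂ) (g : GD d) (S : ℂ) : Prop :=
  Tendsto (fun N : ℕ => walshPartialSum a (fun _ => N) g) atTop (𝓝 S)

/-- `λ`-convergence: `S_𝐍(𝐠) → S` as `min_j N^j → ∞` along `𝐍` with `max N^j/N^k ≤ λ`. -/
def LambdaConverges {d : ℕ} (lam : ℝ) (a : (Fin d → ℕ) → ℂ) (g : GD d) (S : ℂ) : Prop :=
  ∀ ε : ℝ, 0 < ε → ∃ K : ℕ, ∀ N : Fin d → ℕ, (∀ j, K ≤ N j) →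
    (∀ j k, (N j : ℝ) ≤ lam * N k) → ‖walshPartialSum a N g - S‖ < ε

/-- Auxiliary predicate for iterated summation of a multiple series with terms `f`;
the list gives the order of summation, *innermost index first*.  After summing the
series in the variables of the list, the remaining (partially summed) function is `g`. -/
def IterConvAux {d : ℕ} : List (Fin d) → ((Fin d → ℕ) → ℂ) → ((Fin d → ℕ) → ℂ) → Prop
  | [], f, g => f = g
  | j :: rest, f, g => ∃ h : (Fin d → ℕ) → ℂ,
      (∀ n, Tendsto (fun T : ℕ => ∑ t ∈ Finset.range T, f (Function.update n j t))
        atTop (𝓝 (h n))) ∧ IterConvAux rest h g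

/-- The multiple series with terms `f` converges iteratedly to `S`, the order of
summation being given by the list `l` (innermost index first): all successively
nested inner series converge and the full iterated sum equals `S`. -/
def IterConverges {d : ℕ} (l : List (Fin d)) (f : (Fin d → ℕ) → ℂ) (S : ℂ) : Prop :=
  ∃ g, IterConvAux l f g ∧ ∀ n, g n = S

/-- `A` is an M-set for the `d`-dimensional Walsh system under rectangular convergence. -/
def IsMSetRect {d : ℕ} (A : Set (GD d)) : Prop :=
  ∃ a : (Fin d → ℕ) → ℂ, (∃ n, a n ≠ 0) ∧ ∀ g ∉ A, ConvergesOverRectangles a g 0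

/-- `A` is an M-set for the `d`-dimensional Walsh system under convergence over cubes. -/
def IsMSetCubes {d : ℕ} (A : Set (GD d)) : Prop :=
  ∃ a : (Fin d → ℕ) → ℂ, (∃ n, a n ≠ 0) ∧ ∀ g ∉ A, ConvergesOverCubes a g 0

/-- `A` is an M-set under iterated convergence with summation order `l` (innermost first). -/
def IsMSetIter {d : ℕ} (A : Set (GD d)) (l : List (Fin d)) : Prop :=
  ∃ a : (Fin d → ℕ) → ℂ, (∃ n, a n ≠ 0) ∧
    ∀ g ∉ A, IterConverges l (fun n => a n * (walshD n g : ℂ)) 0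

/-- `A` is an M-set for the `d`-dimensional Walsh system under `λ`-convergence. -/
def IsMSetLambda {d : ℕ} (lam : ℝ) (A : Set (GD d)) : Prop :=
  ∃ a : (Fin d → ℕ) → ℂ, (∃ n, a n ≠ 0) ∧ ∀ g ∉ A, LambdaConverges lam a g 0

/-- A quasimeasure: a finitely additive function on dyadic cubes (indexed by rank
`k` and position `𝐦 < 2^k·𝟏`). -/
def IsQuasimeasure {d : ℕ} (τ : ℕ → (Fin d → ℕ) → ℂ) : Prop :=
  ∀ k m, (∀ l, m l < 2 ^ k) →
    τ k m = ∑ σ : Fin d → Fin 2, τ (k + 1) fun l => 2 * m l + (σ l : ℕ)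

/-- The quasimeasure generated by the Walsh series with coefficients `a`:
`τ(Δ^{(k)}_𝐦) = 2^{-kd} ∑_{𝐧<2^k𝟏} a_𝐧 W_𝐧(Δ^{(k)}_𝐦)`. -/
def genQM {d : ℕ} (a : (Fin d → ℕ) → ℂ) (k : ℕ) (m : Fin d → ℕ) : ℂ :=
  ((2 : ℂ) ^ (k * d))⁻¹ * ∑ n ∈ boxLt (fun _ : Fin d => 2 ^ k), a n * (walshValD k n m : ℂ)

/-- The Fourier–Walsh coefficient `τ̂_𝐧` of a quasimeasure `τ`, computed at resolution `k`
(the value does not depend on `k` as long as `𝐧 < 2^k𝟏`). -/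
def fourierCoeffAt {d : ℕ} (τ : ℕ → (Fin d → ℕ) → ℂ) (n : Fin d → ℕ) (k : ℕ) : ℂ :=
  ∑ m ∈ boxLt (fun _ : Fin d => 2 ^ k), (walshValD k n m : ℂ) * τ k m

/-- The local Fourier–Walsh coefficient `τ̂_𝐧(Δ^{(r)}_{𝐦Δ})`, computed at resolution `k ≥ r`. -/
def localCoeffAt {d : ℕ} (τ : ℕ → (Fin d → ℕ) → ℂ) (n : Fin d → ℕ)
    (r : ℕ) (mΔ : Fin d → ℕ) (k : ℕ) : ℂ :=
  ∑ m ∈ (boxLt (fun _ : Fin d => 2 ^ k)).filter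
      (fun m => dyadicCube k m ⊆ dyadicCube r mΔ),
    (walshValD k n m : ℂ) * τ k m

/-- The support of a quasimeasure: the complement of the union of all dyadic cubes `Δ₀`
such that `τ(Δ) = 0` for every dyadic cube `Δ ⊆ Δ₀`. -/
def qmSupport {d : ℕ} (τ : ℕ → (Fin d → ℕ) → ℂ) : Set (GD d) :=
  (⋃ k, ⋃ m ∈ box d k,
    ⋃ (_ : ∀ k' m', (∀ l, m' l < 2 ^ k') →
        dyadicCube k' m' ⊆ dyadicCube k m → τ k' m' = 0),
    dyadicCube k m)ᶜ

/-- The restriction `τ|_{Δ̃}` of a quasimeasure to the dyadic cube `Δ̃ = Δ^{(r)}_{𝐦Δ}`: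
`τ|_{Δ̃}(Δ) = τ(Δ̃ ∩ Δ)` (two dyadic cubes are nested or disjoint). -/
def restrictQM {d : ℕ} (τ : ℕ → (Fin d → ℕ) → ℂ) (r : ℕ) (mΔ : Fin d → ℕ) :
    ℕ → (Fin d → ℕ) → ℂ := fun k m =>
  if dyadicCube k m ⊆ dyadicCube (d := d) r mΔ then τ k m
  else if dyadicCube (d := d) r mΔ ⊆ dyadicCube k m then τ r mΔ
  else 0

/-- `τ` is the canonical quasimeasure `τ_E` associated with a (nonempty closed) set `E`:
`τ(𝔾^d) = 1`; `τ(Δ) = 0` iff `Δ ∩ E = ∅`; and the mass of a cube meeting `E` is divided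
equally among its `2^d` immediate subcubes that meet `E`. -/
def IsTauOf {d : ℕ} (E : Set (GD d)) (τ : ℕ → (Fin d → ℕ) → ℂ) : Prop :=
  IsQuasimeasure τ ∧
  τ 0 (fun _ => 0) = 1 ∧
  (∀ k m, (∀ l, m l < 2 ^ k) → (τ k m = 0 ↔ dyadicCube k m ∩ E = ∅)) ∧
  (∀ k m, (∀ l, m l < 2 ^ k) → (dyadicCube k m ∩ E).Nonempty →
    ∀ σ : Fin d → Fin 2,
      τ (k + 1) (fun l => 2 * m l + (σ l : ℕ)) =
        if (dyadicCube (k + 1) (fun l => 2 * m l + (σ l : ℕ)) ∩ E).Nonempty then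
          τ k m / ((Finset.univ.filter fun σ' : Fin d → Fin 2 =>
              (dyadicCube (k + 1) (fun l => 2 * m l + (σ' l : ℕ)) ∩ E).Nonempty).card : ℂ)
        else 0)

/-- The sequence `m_s`: `m_1 = 0`, `m_{s+1} = 2(2m_s+1)` (value at `0` is junk). -/
def mSeq : ℕ → ℕ
  | 0 => 0
  | s + 1 => if s = 0 then 0 else 2 * (2 * mSeq s + 1)

/-- The layer `F_s^π`. -/
def Fspi {d : ℕ} (π : ℕ → (Fin d → ℕ) → Fin d → ℕ) (s : ℕ) : Set (GD d) :=
  ⋃ m ∈ box d (mSeq s), ⋃ m' ∈ box d (mSeq s),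
    {g | g ∈ dyadicCube (2 * mSeq s) (fun l => 2 ^ mSeq s * m l + m' l) ∧
      walshD (fun _ => 2 ^ (2 * mSeq s)) g = walshValD (mSeq s) (π s m) m'}

/-- `F̃_s^π = F_1^π ∩ ⋯ ∩ F_s^π` (so `F̃_0^π = 𝔾^d`). -/
def Ftil {d : ℕ} (π : ℕ → (Fin d → ℕ) → Fin d → ℕ) (s : ℕ) : Set (GD d) :=
  ⋂ k ∈ Finset.Icc 1 s, Fspi π k

/-- `F^π = ⋂_{s≥1} F_s^π`. -/
def Fpi {d : ℕ} (π : ℕ → (Fin d → ℕ) → Fin d → ℕ) : Set (GD d) :=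
  ⋂ s ∈ Set.Ici 1, Fspi π s

/-- The identity element of `S` (yielding `F_s`, `F̃_s` and `F` themselves). -/
def idPerm (d : ℕ) : ℕ → (Fin d → ℕ) → Fin d → ℕ := fun _ m => m

/-- `S`: sequences `π = (π_s)` of permutations of the boxes `{0,…,2^{m_s}−1}^d`. -/
structure PermSeq (d : ℕ) where
  p : ℕ → Equiv.Perm (Fin d → ℕ)
  maps : ∀ s, Set.MapsTo (p s) (box d (mSeq s)) (box d (mSeq s))

/-- The underlying sequence of functions of an element of `S`. -/
def PermSeq.f {d : ℕ} (π : PermSeq d) : ℕ → (Fin d → ℕ) → Fin d → ℕ := fun s => ⇑(π.p s)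

/-- `π ∈ S'`: every `π_s` acts coordinatewise, `π_s(𝐦) = (π_s^1(m^1),…,π_s^d(m^d))`. -/
def PermSeq.Coordinatewise {d : ℕ} (π : PermSeq d) : Prop :=
  ∀ s, ∃ e : Fin d → ℕ → ℕ, ∀ m : Fin d → ℕ, π.p s m = fun l => e l (m l)

/-- The Dirichlet kernel `D_N = ∑_{n<N} W_n` of the one-dimensional Walsh system. -/
def dirichlet (N : ℕ) (g : DyadicGroup) : ℝ :=
  ∑ n ∈ Finset.range N, walsh n g

/-- sign of a digit -/
def sg (x : ZMod 2) : ℝ := if x = 1 then -1 else 1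

/-- shift of a sequence -/
def shf (k : ℕ) (g : DyadicGroup) : DyadicGroup := fun t => g (k + t)

/-- index of the dyadic interval of rank k containing g -/
def idx : ℕ → DyadicGroup → ℕ
  | 0, _ => 0
  | k + 1, g => 2 * idx k g + (if g k = 1 then 1 else 0)

/-- agreement of the first k digits -/
def agr (k : ℕ) (g h : DyadicGroup) : Prop := ∀ t < k, g t = h t

lemma sg_mul_self (x : ZMod 2) : sg x * sg x = 1 := by unfold sg; split_ifs <;> norm_num

lemma sg_abs (x : ZMod 2) : |sg x| = 1 := by unfold sg; split_ifs <;> norm_num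

lemma zmod2_cases (x : ZMod 2) : x = 0 ∨ x = 1 := by revert x; decide

lemma walsh_eq (n K : ℕ) (h : n < 2 ^ K) (g : DyadicGroup) :
    walsh n g = ∏ k ∈ Finset.range K, if n.testBit k then sg (g k) else 1 := by
  have e : ∀ k, (if n.testBit k ∧ g k = 1 then (-1 : ℝ) else 1)
      = if n.testBit k then sg (g k) else 1 := by
    intro k; unfold sg; split_ifs <;> simp_all
  unfold walsh
  simp_rw [e]
  have big : ∀ L, n < 2 ^ L → ∏ k ∈ Finset.range L, (if n.testBit k then sg (g k) else 1)
      = ∏ k ∈ Finset.range (max L (max n K)), (if n.testBit k then sg (g k) else 1) := by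
    intro L hL
    apply Finset.prod_subset
    · intro x; simp; omega
    · intro x _ hx
      simp at hx
      rw [Nat.testBit_lt_two_pow (lt_of_lt_of_le hL (Nat.pow_le_pow_right (by norm_num) hx))]
      simp
  rw [big n Nat.lt_two_pow_self, big K h]
  congr 2; omega

lemma walsh_zero (g : DyadicGroup) : walsh 0 g = 1 := by simp [walsh]

lemma walsh_abs (n : ℕ) (g : DyadicGroup) : |walsh n g| = 1 := by
  unfold walsh
  rw [Finset.abs_prod]
  apply Finset.prod_eq_one
  intro i _
  split_ifs <;> norm_num

lemma walsh_sq (n : ℕ) (g : DyadicGroup) : walsh n g * walsh n g = 1 := by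
  rw [← abs_mul_abs_self, walsh_abs]; norm_num

lemma walsh_congr {n k : ℕ} (hn : n < 2 ^ k) {g h : DyadicGroup} (H : agr k g h) :
    walsh n g = walsh n h := by
  rw [walsh_eq n k hn, walsh_eq n k hn]
  apply Finset.prod_congr rfl
  intro i hi
  rw [H i (Finset.mem_range.1 hi)]

lemma walsh_xor (n i : ℕ) (g : DyadicGroup) :
    walsh (n ^^^ 2 ^ i) g = walsh n g * sg (g i) := by
  have h1 : n < 2 ^ (n + i + 1) :=
    lt_of_lt_of_le Nat.lt_two_pow_self (Nat.pow_le_pow_right (by norm_num) (by omega))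
  have h2 : 2 ^ i < 2 ^ (n + i + 1) := Nat.pow_lt_pow_right (by norm_num) (by omega)
  rw [walsh_eq _ (n + i + 1) (Nat.xor_lt_two_pow h1 h2), walsh_eq n (n + i + 1) h1]
  have hi : i ∈ Finset.range (n + i + 1) := by simp
  rw [← Finset.mul_prod_erase _ _ hi, ← Finset.mul_prod_erase _ _ hi]
  have : ∏ x ∈ (Finset.range (n + i + 1)).erase i,
      (if (n ^^^ 2 ^ i).testBit x then sg (g x) else 1)
      = ∏ x ∈ (Finset.range (n + i + 1)).erase i, (if n.testBit x then sg (g x) else 1) := by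
    apply Finset.prod_congr rfl
    intro x hx
    have : x ≠ i := (Finset.mem_erase.1 hx).1
    rw [Nat.testBit_xor, Nat.testBit_two_pow_of_ne this.symm]
    simp
  rw [this, Nat.testBit_xor, Nat.testBit_two_pow_self]
  cases n.testBit i
  · simp; ring
  · have := sg_mul_self (g i)
    simp
    linear_combination (-∏ x ∈ (Finset.range (n + i + 1)).erase i, (if n.testBit x then sg (g x) else 1)) * this

lemma walsh_split (m n j : ℕ) (hj : j < 2 ^ m) (g : DyadicGroup) :
    walsh (2 ^ m * n + j) g = walsh j g * walsh n (shf m g) := by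
  have h1 : 2 ^ m * n + j < 2 ^ (m + n) := by
    rw [pow_add]
    have : n + 1 ≤ 2 ^ n := Nat.lt_two_pow_self
    nlinarith [Nat.mul_le_mul_left (2 ^ m) this]
  rw [walsh_eq _ (m + n) h1, walsh_eq j m hj, walsh_eq n n Nat.lt_two_pow_self,
    Finset.prod_range_add]
  congr 1
  · apply Finset.prod_congr rfl
    intro i hi
    rw [Nat.testBit_two_pow_mul_add _ hj]
    simp [Finset.mem_range.1 hi]
  · apply Finset.prod_congr rfl
    intro i hi
    rw [Nat.testBit_two_pow_mul_add _ hj]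
    simp [shf]

lemma walsh_one (g : DyadicGroup) : walsh 1 g = sg (g 0) := by
  simp [walsh, sg]

lemma walsh_top (m j : ℕ) (hj : j < 2 ^ m) (g : DyadicGroup) :
    walsh (j + 2 ^ m) g = sg (g m) * walsh j g := by
  have := walsh_split m 1 j hj g
  rw [walsh_one] at this
  rw [show j + 2 ^ m = 2 ^ m * 1 + j by ring, this]
  simp [shf]; ring

lemma idx_lt (k : ℕ) (g : DyadicGroup) : idx k g < 2 ^ k := by
  induction k with
  | zero => simp [idx]
  | succ k ih => simp only [idx, pow_succ]; split_ifs <;> omega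

lemma idx_testBit (k : ℕ) (g : DyadicGroup) : ∀ t < k,
    (idx k g).testBit (k - 1 - t) = decide (g t = 1) := by
  induction k with
  | zero => simp
  | succ k ih =>
    intro t ht
    rcases Nat.lt_succ_iff_lt_or_eq.1 ht with h | h
    · have : k + 1 - 1 - t = (k - 1 - t) + 1 := by omega
      rw [this, Nat.testBit_succ, ← ih t h]
      congr 1
      simp only [idx]; split_ifs <;> omega
    · subst h
      simp only [idx, add_tsub_cancel_right, tsub_self, Nat.testBit_zero]
      split_ifs with h <;> simp [h, Nat.add_mod]

lemma mem_int_idx (k : ℕ) (g h : DyadicGroup) :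
    g ∈ dyadicInterval k (idx k h) ↔ agr k g h := by
  unfold dyadicInterval agr
  simp only [Set.mem_ofPred_eq]
  refine forall₂_congr fun t ht => ?_
  rw [idx_testBit k h t ht]
  rcases zmod2_cases (h t) with e | e <;> simp [e]

lemma pt_agr (k : ℕ) (g : DyadicGroup) : agr k (intervalPoint k (idx k g)) g := by
  intro t ht
  unfold intervalPoint
  rw [idx_testBit k g t ht]
  rcases zmod2_cases (g t) with e | e <;> simp [e, ht]

lemma idx_congr {k : ℕ} {g h : DyadicGroup} (H : agr k g h) : idx k g = idx k h := by
  induction k with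
  | zero => simp [idx]
  | succ k ih =>
    simp only [idx]
    rw [ih (fun t ht => H t (by omega)), H k (by omega)]

lemma idx_inj {k : ℕ} {g h : DyadicGroup} (H : idx k g = idx k h) : agr k g h := by
  rw [← mem_int_idx, ← H, mem_int_idx]; intro t _; rfl

lemma idx_pt {k m : ℕ} (hm : m < 2 ^ k) : idx k (intervalPoint k m) = m := by
  apply Nat.eq_of_testBit_eq
  intro i
  by_cases hi : i < k
  · have h1 : k - 1 - (k - 1 - i) = i := by omega
    have h2 : k - 1 - i < k := by omega
    have := idx_testBit k (intervalPoint k m) (k - 1 - i) h2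
    rw [h1] at this
    rw [this]
    simp only [intervalPoint, h1, h2, true_and]
    split_ifs with h <;> simp [h]
  · have hp : 2 ^ k ≤ 2 ^ i := Nat.pow_le_pow_right (by norm_num) (by omega)
    rw [Nat.testBit_lt_two_pow (lt_of_lt_of_le hm hp),
      Nat.testBit_lt_two_pow (lt_of_lt_of_le (idx_lt _ _) hp)]

lemma walshVal_symm {k n m : ℕ} (hn : n < 2 ^ k) (hm : m < 2 ^ k) :
    walsh n (intervalPoint k m) = walsh m (intervalPoint k n) := by
  rw [walsh_eq n k hn, walsh_eq m k hm, ← Finset.prod_range_reflect]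
  apply Finset.prod_congr rfl
  intro i hi
  have hi := Finset.mem_range.1 hi
  have h1 : k - 1 - (k - 1 - i) = i := by omega
  have h2 : k - 1 - i < k := by omega
  simp only [intervalPoint, h1, h2, hi, true_and, sg]
  split_ifs <;> simp_all

/-- Dirichlet type sum vanishing over full blocks. -/
lemma dir_zero {i K q : ℕ} (hi : i < K) {g h : DyadicGroup} (H : g i ≠ h i) :
    ∑ n ∈ Finset.range (2 ^ K * q), walsh n g * walsh n h = 0 := by
  have hs : sg (g i) * sg (h i) = -1 := by
    rcases zmod2_cases (g i) with e | e <;> rcases zmod2_cases (h i) with e' | e' <;>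
      simp_all [sg]
  have key : ∀ n, walsh (n ^^^ 2 ^ i) g * walsh (n ^^^ 2 ^ i) h = -(walsh n g * walsh n h) := by
    intro n
    rw [walsh_xor, walsh_xor]
    linear_combination (walsh n g * walsh n h) * hs
  have hm : ∀ n ∈ Finset.range (2 ^ K * q), n ^^^ 2 ^ i ∈ Finset.range (2 ^ K * q) := by
    intro n hn
    rw [Finset.mem_range] at *
    rw [mul_comm, ← Nat.div_lt_iff_lt_mul (by positivity)] at *
    rw [← Nat.shiftRight_eq_div_pow, Nat.shiftRight_xor_distrib, Nat.shiftRight_eq_div_pow,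
      Nat.shiftRight_eq_div_pow, Nat.div_eq_of_lt (Nat.pow_lt_pow_right (by norm_num) hi)]
    simpa using hn
  have : ∑ n ∈ Finset.range (2 ^ K * q), walsh n g * walsh n h
      = ∑ n ∈ Finset.range (2 ^ K * q), -(walsh n g * walsh n h) := by
    apply Finset.sum_nbij' (fun n => n ^^^ 2 ^ i) (fun n => n ^^^ 2 ^ i) hm hm
    · intro n _; simp
    · intro n _; simp
    · intro n _; rw [key]; ring
  rw [Finset.sum_neg_distrib] at this
  linarith

lemma dir_trivial (z : ℕ) (g h : DyadicGroup) (A : ℕ → ℕ) :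
    |∑ n ∈ Finset.range z, walsh (A n) g * walsh (A n) h| ≤ z := by
  refine (Finset.abs_sum_le_sum_abs _ _).trans ?_
  simp [abs_mul, walsh_abs]

lemma dir_small {i K z : ℕ} (hi : i < K) {g h : DyadicGroup} (H : g i ≠ h i) :
    |∑ n ∈ Finset.range z, walsh n g * walsh n h| ≤ 2 ^ K := by
  conv_lhs => rw [← Nat.div_add_mod z (2 ^ K)]
  rw [Finset.sum_range_add, dir_zero hi H, zero_add]
  refine (dir_trivial _ _ _ _).trans ?_
  exact_mod_cast (Nat.mod_lt z (by positivity)).le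

lemma dir_full (K : ℕ) (g h : DyadicGroup) :
    ∑ n ∈ Finset.range (2 ^ K), walsh n g * walsh n h = if agr K g h then 2 ^ K else 0 := by
  split_ifs with H
  · rw [Finset.sum_congr rfl (g := fun _ => (1 : ℝ))]
    · simp
    · intro n hn
      rw [walsh_congr (Finset.mem_range.1 hn) H, walsh_sq]
  · unfold agr at H
    push Not at H
    obtain ⟨i, hi, h'⟩ := H
    have := dir_zero (q := 1) hi h'
    simpa using this


def agrD {d : ℕ} (k : ℕ) (g h : GD d) : Prop := ∀ l, agr k (g l) (h l)

def mm (s : ℕ) : ℕ := mSeq (s + 1)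

lemma mm_zero : mm 0 = 0 := by simp [mm, mSeq]

lemma mm_succ (s : ℕ) : mm (s + 1) = 2 * (2 * mm s + 1) := by
  simp [mm, mSeq]

lemma mm_lt {t s : ℕ} (h : t < s) : 2 * mm t + 1 ≤ mm s := by
  induction s with
  | zero => omega
  | succ s ih =>
    rw [mm_succ]
    rcases Nat.lt_succ_iff_lt_or_eq.1 h with h | h
    · have := ih h; omega
    · subst h; omega

lemma mm_mono {t s : ℕ} (h : t ≤ s) : mm t ≤ mm s := by
  rcases h.lt_or_eq with h | h
  · have := mm_lt h; omega
  · rw [h]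

lemma le_mm (s : ℕ) : s ≤ mm s := by
  induction s with
  | zero => omega
  | succ s ih => rw [mm_succ]; omega

lemma mm_big (s : ℕ) : 2 * s ≤ 2 * mm s + 1 + 1 := by
  have := le_mm s; omega

lemma agr_mono {k k' : ℕ} (h : k ≤ k') {g g' : DyadicGroup} (H : agr k' g g') : agr k g g' :=
  fun t ht => H t (by omega)

lemma agrD_mono {d k k' : ℕ} (h : k ≤ k') {g g' : GD d} (H : agrD k' g g') : agrD k g g' :=
  fun l => agr_mono h (H l)

lemma idx_add (a b : ℕ) (g : DyadicGroup) :
    idx (a + b) g = 2 ^ b * idx a g + idx b (shf a g) := by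
  induction b with
  | zero => simp [idx]
  | succ b ih =>
    rw [← add_assoc]
    simp only [idx, ih, shf, pow_succ]
    ring

lemma mem_int {k x : ℕ} (hx : x < 2 ^ k) (g : DyadicGroup) :
    g ∈ dyadicInterval k x ↔ idx k g = x := by
  constructor
  · intro h
    rw [← idx_pt hx] at h
    rw [mem_int_idx] at h
    rw [idx_congr h, idx_pt hx]
  · rintro rfl
    rw [mem_int_idx]; intro t _; rfl

/-- the sign function whose value 1 defines the layer `F_{s+1}` -/
def Rs {d : ℕ} (s : ℕ) (g : GD d) : ℝ :=
  ∏ l, (sg (g l (2 * mm s)) * walsh (idx (mm s) (g l)) (shf (mm s) (g l)))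

lemma Rs_sq {d : ℕ} (s : ℕ) (g : GD d) : Rs s g * Rs s g = 1 := by
  unfold Rs
  rw [← Finset.prod_mul_distrib]
  apply Finset.prod_eq_one
  intro l _
  have h1 := sg_mul_self (g l (2 * mm s))
  have h2 := walsh_sq (idx (mm s) (g l)) (shf (mm s) (g l))
  linear_combination (walsh (idx (mm s) (g l)) (shf (mm s) (g l)))^2 * h1 + h2

lemma Rs_pm {d : ℕ} (s : ℕ) (g : GD d) : Rs s g = 1 ∨ Rs s g = -1 :=
  mul_self_eq_one_iff.1 (Rs_sq s g)

lemma Rs_congr {d : ℕ} {s : ℕ} {g h : GD d} (H : agrD (2 * mm s + 1) g h) :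
    Rs s g = Rs s h := by
  unfold Rs
  apply Finset.prod_congr rfl
  intro l _
  rw [H l _ (by omega), idx_congr (agr_mono (by omega) (H l))]
  congr 1
  apply walsh_congr (idx_lt _ _)
  intro t ht
  exact H l _ (by omega)

lemma shf_pt_agr (M : ℕ) (g : DyadicGroup) (n : ℕ) (hn : n < 2 ^ M) :
    walsh n (intervalPoint M (idx M g)) = walsh n g :=
  walsh_congr hn (pt_agr M g)

lemma mem_Fspi {d : ℕ} (s : ℕ) (g : GD d) :
    g ∈ Fspi (idPerm d) (s + 1) ↔ Rs s g = 1 := by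
  have key : walshD (fun _ => 2 ^ (2 * mm s)) g
      = walshValD (mm s) (fun l => idx (mm s) (g l)) (fun l => idx (mm s) (shf (mm s) (g l)))
      ↔ Rs s g = 1 := by
    have e1 : walshD (fun _ => 2 ^ (2 * mm s)) g = ∏ l, sg (g l (2 * mm s)) := by
      unfold walshD
      apply Finset.prod_congr rfl
      intro l _
      have := walsh_top (2 * mm s) 0 (by positivity) (g l)
      simpa [walsh_zero] using this
    have e2 : walshValD (mm s) (fun l => idx (mm s) (g l))
        (fun l => idx (mm s) (shf (mm s) (g l)))
        = ∏ l, walsh (idx (mm s) (g l)) (shf (mm s) (g l)) := by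
      unfold walshValD walshD cubePoint
      apply Finset.prod_congr rfl
      intro l _
      exact shf_pt_agr _ _ _ (idx_lt _ _)
    have e3 : (∏ l, walsh (idx (mm s) (g l)) (shf (mm s) (g l)))
        * (∏ l, walsh (idx (mm s) (g l)) (shf (mm s) (g l))) = 1 := by
      rw [← Finset.prod_mul_distrib]
      apply Finset.prod_eq_one
      intro l _
      exact walsh_sq _ _
    rw [e1, e2]
    unfold Rs
    rw [Finset.prod_mul_distrib]
    constructor
    · intro h; rw [h, e3]
    · intro h
      have := congrArg (fun x => x * ∏ l, walsh (idx (mm s) (g l)) (shf (mm s) (g l))) h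
      simp only [mul_assoc, e3, mul_one, one_mul] at this
      exact this
  rw [← key]
  unfold Fspi
  simp only [Set.mem_iUnion, Set.mem_ofPred_eq, idPerm, _root_.box]
  change (∃ m, ∃ (_ : ∀ l, m l < 2 ^ (mm s)), ∃ m', ∃ (_ : ∀ l, m' l < 2 ^ (mm s)),
    g ∈ dyadicCube (2 * mm s) (fun l => 2 ^ mm s * m l + m' l) ∧ 
      walshD (fun _ => 2 ^ (2 * mm s)) g = walshValD (mm s) m m') ↔ _
  have idd : ∀ l, idx (2 * mm s) (g l)
      = 2 ^ mm s * idx (mm s) (g l) + idx (mm s) (shf (mm s) (g l)) := by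
    intro l; rw [two_mul, idx_add]
  constructor
  · rintro ⟨m, hm, m', hm', hg, hw⟩
    have hE : ∀ l, idx (mm s) (g l) = m l ∧ idx (mm s) (shf (mm s) (g l)) = m' l := by
      intro l
      have h1 := hg l
      rw [mem_int, idd] at h1
      · have a1 := congrArg (fun x => x / 2 ^ mm s) h1
        have a2 := congrArg (fun x => x % 2 ^ mm s) h1
        simp only [Nat.mul_add_mod, Nat.mod_eq_of_lt (hm' l), Nat.mod_eq_of_lt (idx_lt _ _)] at a2
        simp only [Nat.mul_add_div (show 2 ^ mm s > 0 by positivity), Nat.div_eq_of_lt (hm' l),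
          Nat.div_eq_of_lt (idx_lt _ _), add_zero] at a1
        exact ⟨a1, a2⟩
      · rw [two_mul, pow_add]
        have := hm l
        have := hm' l
        nlinarith
    rw [show (fun l => idx (mm s) (g l)) = m from funext fun l => (hE l).1,
      show (fun l => idx (mm s) (shf (mm s) (g l))) = m' from funext fun l => (hE l).2]
    exact hw
  · intro h
    refine ⟨_, fun l => idx_lt _ _, _, fun l => idx_lt _ _, ?_, h⟩
    intro l
    show g l ∈ dyadicInterval (2 * mm s) (2 ^ mm s * idx (mm s) (g l) + idx (mm s) (shf (mm s) (g l)))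
    rw [← idd, mem_int_idx]
    intro t _; rfl

lemma mem_Fpi {d : ℕ} (g : GD d) : g ∈ Fpi (idPerm d) ↔ ∀ s, Rs s g = 1 := by
  unfold Fpi
  simp only [Set.mem_iInter, Set.mem_Ici]
  constructor
  · intro h s
    rw [← mem_Fspi]; exact h _ (by omega)
  · intro h s hs
    obtain ⟨t, rfl⟩ : ∃ t, s = t + 1 := ⟨s - 1, by omega⟩
    rw [mem_Fspi]; exact h _

/-- the partial products -/
def PP {d : ℕ} (s : ℕ) (g : GD d) : ℝ := ∏ t ∈ Finset.range s, (1 + Rs t g)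

lemma PP_nonneg {d : ℕ} (s : ℕ) (g : GD d) : 0 ≤ PP s g := by
  apply Finset.prod_nonneg
  intro t _
  rcases Rs_pm t g with h | h <;> rw [h] <;> norm_num

lemma PP_le {d : ℕ} (s : ℕ) (g : GD d) : PP s g ≤ 2 ^ s := by
  unfold PP
  calc _ ≤ ∏ t ∈ Finset.range s, (2 : ℝ) := by
        apply Finset.prod_le_prod
        · intro t _
          rcases Rs_pm t g with h | h <;> rw [h] <;> norm_num
        · intro t _
          rcases Rs_pm t g with h | h <;> rw [h] <;> norm_num
    _ = _ := by simp

lemma PP_congr {d s k : ℕ} (hk : ∀ t < s, 2 * mm t + 1 ≤ k) {g h : GD d} (H : agrD k g h) :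
    PP s g = PP s h := by
  unfold PP
  apply Finset.prod_congr rfl
  intro t ht
  rw [Rs_congr (agrD_mono (hk t (Finset.mem_range.1 ht)) H)]

/-- coefficients in the block `s` -/
def bet {d : ℕ} (s : ℕ) (n : Fin d → ℕ) : ℝ :=
  PP s (fun l => intervalPoint (mm s) (n l / 2 ^ mm s)) *
    ∏ l, ((2 : ℝ) ^ mm s)⁻¹ * walsh (n l % 2 ^ mm s) (intervalPoint (mm s) (n l / 2 ^ mm s))

/-- one-dimensional factor -/
def XX (M N : ℕ) (g : DyadicGroup) (j : ℕ) : ℝ :=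
  ∑ n ∈ (Finset.range N).filter (fun n => n / 2 ^ M = j),
    ((2 : ℝ) ^ M)⁻¹ * walsh (n % 2 ^ M) (intervalPoint M (n / 2 ^ M)) * walsh n g

lemma T_eq {d : ℕ} (s : ℕ) (N : Fin d → ℕ) (hN : ∀ l, N l ≤ 2 ^ (2 * mm s)) (g : GD d) :
    ∑ n ∈ boxLt N, bet s n * walshD n g
      = ∑ j ∈ boxLt (fun _ : Fin d => 2 ^ mm s), PP s (fun l => intervalPoint (mm s) (j l)) *
          ∏ l, XX (mm s) (N l) (g l) (j l) := by
  rw [← Finset.sum_fiberwise_of_maps_to (s := boxLt N)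
    (t := boxLt (fun _ : Fin d => 2 ^ mm s)) (g := fun n l => n l / 2 ^ mm s)]
  · apply Finset.sum_congr rfl
    intro j _
    have e : (boxLt N).filter (fun n => (fun l => n l / 2 ^ mm s) = j)
        = Fintype.piFinset (fun l => (Finset.range (N l)).filter (fun n => n / 2 ^ mm s = j l)) := by
      ext n
      simp only [boxLt, Finset.mem_filter, Fintype.mem_piFinset, funext_iff]
      exact forall_and.symm
    rw [e]
    unfold XX
    rw [Finset.prod_univ_sum, Finset.mul_sum]
    apply Finset.sum_congr rfl
    intro n hn
    have hj : ∀ l, n l / 2 ^ mm s = j l := by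
      intro l
      have := Fintype.mem_piFinset.1 hn l
      exact (Finset.mem_filter.1 this).2
    unfold bet walshD
    rw [mul_assoc, ← Finset.prod_mul_distrib]
    congr 2
    funext l
    rw [hj l]
  · intro n hn
    simp only [boxLt, Fintype.mem_piFinset, Finset.mem_range] at *
    intro l
    rw [Nat.div_lt_iff_lt_mul (by positivity), ← pow_add, ← two_mul]
    exact lt_of_lt_of_le (hn l) (hN l)

lemma XX_eq (M N : ℕ) (g : DyadicGroup) (j : ℕ) :
    XX M N g j = ((2 : ℝ) ^ M)⁻¹ * walsh j (shf M g) *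
      ∑ n ∈ Finset.range (min (2 ^ M) (N - 2 ^ M * j)), walsh n (intervalPoint M j) * walsh n g := by
  unfold XX
  rw [Finset.mul_sum]
  have hp : 0 < 2 ^ M := by positivity
  apply Finset.sum_nbij' (fun n => n % 2 ^ M) (fun n => 2 ^ M * j + n)
  · intro n hn
    simp only [Finset.mem_filter, Finset.mem_range] at *
    have := Nat.div_add_mod n (2 ^ M)
    have h2 := Nat.mod_lt n hp
    rw [hn.2] at this
    omega
  · intro n hn
    simp only [Finset.mem_filter, Finset.mem_range] at *
    refine ⟨by omega, ?_⟩
    rw [Nat.mul_add_div hp, Nat.div_eq_of_lt (by omega)]; simp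
  · intro n hn
    simp only [Finset.mem_filter, Finset.mem_range] at *
    have := Nat.div_add_mod n (2 ^ M)
    rw [hn.2] at this
    exact this
  · intro n hn
    simp only [Finset.mem_range] at *
    rw [Nat.mul_add_mod, Nat.mod_eq_of_lt (by omega)]
  · intro n hn
    simp only [Finset.mem_filter, Finset.mem_range] at *
    rw [hn.2]
    have := Nat.div_add_mod n (2 ^ M)
    rw [hn.2] at this
    conv_lhs => rw [← this]
    rw [walsh_split _ _ _ (Nat.mod_lt n hp), this]
    ring

lemma XX_le_one (M N : ℕ) (g : DyadicGroup) (j : ℕ) : |XX M N g j| ≤ 1 := by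
  rw [XX_eq, abs_mul, abs_mul, walsh_abs, mul_one, abs_inv, abs_of_pos (by positivity),
    inv_mul_le_iff₀ (by positivity), mul_one]
  refine (dir_trivial _ _ _ (fun n => n)).trans ?_
  exact_mod_cast min_le_left _ _

lemma XX_small (M N K : ℕ) (g : DyadicGroup) (j : ℕ) (H : ¬ agr K (intervalPoint M j) g) :
    |XX M N g j| ≤ 2 ^ K / 2 ^ M := by
  unfold agr at H
  push Not at H
  obtain ⟨i, hi, h⟩ := H
  rw [XX_eq, abs_mul, abs_mul, walsh_abs, mul_one, abs_inv, abs_of_pos (by positivity),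
    inv_mul_eq_div]
  gcongr
  exact dir_small hi h

lemma XX_full (M N : ℕ) (g : DyadicGroup) (j : ℕ) (hj : j < 2 ^ M) (hN : 2 ^ M * (j + 1) ≤ N) :
    XX M N g j = if j = idx M g then walsh j (shf M g) else 0 := by
  have : min (2 ^ M) (N - 2 ^ M * j) = 2 ^ M := by
    rw [mul_add] at hN; omega
  rw [XX_eq, this, dir_full]
  have e : agr M (intervalPoint M j) g ↔ j = idx M g := by
    constructor
    · intro h; rw [← idx_congr h, idx_pt hj]
    · rintro rfl; exact pt_agr _ _
  simp only [e]
  split_ifs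
  · field_simp
  · simp

lemma XX_ne (M N : ℕ) (g : DyadicGroup) (j : ℕ) (hj : j < 2 ^ M) (h : XX M N g j ≠ 0) :
    j = idx M g ∨ j = N / 2 ^ M := by
  by_contra! hc
  apply h
  have hp : 0 < 2 ^ M := by positivity
  rcases lt_or_gt_of_ne hc.2 with h1 | h1
  · rw [XX_full M N g j hj, if_neg hc.1]
    rw [mul_comm]
    exact (Nat.le_div_iff_mul_le hp).1 h1
  · rw [XX_eq]
    have : N - 2 ^ M * j = 0 := by
      rw [Nat.div_lt_iff_lt_mul hp, mul_comm] at h1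
      omega
    rw [this]; simp

lemma T_full {d : ℕ} (s : ℕ) (g : GD d) :
    ∑ n ∈ boxLt (fun _ : Fin d => 2 ^ (2 * mm s)), bet s n * walshD n g
      = PP s g * ∏ l, walsh (idx (mm s) (g l)) (shf (mm s) (g l)) := by
  rw [T_eq _ _ (fun _ => le_rfl)]
  have hX : ∀ j ∈ boxLt (fun _ : Fin d => 2 ^ mm s), ∀ l,
      XX (mm s) (2 ^ (2 * mm s)) (g l) (j l) =
        if j l = idx (mm s) (g l) then walsh (j l) (shf (mm s) (g l)) else 0 := by
    intro j hj l
    have hj : j l < 2 ^ mm s := by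
      have := Fintype.mem_piFinset.1 hj l
      simpa using this
    apply XX_full _ _ _ _ hj
    rw [two_mul, pow_add]
    exact Nat.mul_le_mul_left _ hj
  rw [Finset.sum_eq_single (fun l => idx (mm s) (g l))]
  · congr 1
    · exact PP_congr (fun t ht => mm_lt ht) (fun l => pt_agr _ _)
    · apply Finset.prod_congr rfl
      intro l _
      rw [hX (fun l => idx (mm s) (g l)) _ l, if_pos rfl]
      simp [boxLt, idx_lt]
  · intro j hj hne
    obtain ⟨l, hl⟩ := Function.ne_iff.1 hne
    rw [Finset.prod_eq_zero (Finset.mem_univ l), mul_zero]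
    rw [hX j hj, if_neg hl]
  · intro h
    exfalso; apply h
    simp [boxLt, idx_lt]

lemma walshD_top {d : ℕ} (k : ℕ) (n : Fin d → ℕ) (hn : ∀ l, n l < 2 ^ k) (g : GD d) :
    walshD (fun l => n l + 2 ^ k) g = (∏ l, sg (g l k)) * walshD n g := by
  unfold walshD
  rw [← Finset.prod_mul_distrib]
  apply Finset.prod_congr rfl
  intro l _
  exact walsh_top _ _ (hn l) _

lemma mem_boxLt {d : ℕ} (N n : Fin d → ℕ) : n ∈ boxLt N ↔ ∀ l, n l < N l := by
  simp [boxLt]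

lemma PP_expand {d : ℕ} (s : ℕ) (g : GD d) :
    PP s g = 1 + ∑ t ∈ Finset.range s, ∑ n ∈ boxLt (fun _ : Fin d => 2 ^ (2 * mm t)),
      bet t n * walshD (fun l => n l + 2 ^ (2 * mm t)) g := by
  induction s with
  | zero => simp [PP]
  | succ s ih =>
    rw [Finset.sum_range_succ, ← add_assoc, ← ih]
    have : ∑ n ∈ boxLt (fun _ : Fin d => 2 ^ (2 * mm s)),
      bet s n * walshD (fun l => n l + 2 ^ (2 * mm s)) g = (∏ l, sg (g l (2 * mm s))) *
      ∑ n ∈ boxLt (fun _ : Fin d => 2 ^ (2 * mm s)), bet s n * walshD n g := by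
      rw [Finset.mul_sum]
      apply Finset.sum_congr rfl
      intro n hn
      rw [walshD_top _ _ ((mem_boxLt _ _).1 hn)]
      ring
    rw [this, T_full]
    unfold PP
    rw [Finset.prod_range_succ]
    unfold Rs
    rw [Finset.prod_mul_distrib]
    ring

lemma T_bound {d : ℕ} (s : ℕ) (N : Fin d → ℕ) (hN : ∀ l, N l ≤ 2 ^ (2 * mm (s + 1))) (g : GD d)
    (hg : PP (s + 1) g = 0) :
    |∑ n ∈ boxLt N, bet (s + 1) n * walshD n g| ≤ 2 ^ d * (2 ^ (s + 1) / 2 ^ (2 * mm s + 1)) := by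
  rw [T_eq _ _ hN]
  set M := mm (s + 1) with hM
  set C := Fintype.piFinset (fun l : Fin d => ({idx M (g l), N l / 2 ^ M} : Finset ℕ)) with hC
  have hcard : (C.card : ℝ) ≤ 2 ^ d := by
    rw [hC, Fintype.card_piFinset]
    push_cast
    calc _ ≤ ∏ _l : Fin d, (2 : ℝ) := by
          apply Finset.prod_le_prod
          · intros; positivity
          · intros; exact_mod_cast Finset.card_le_two
      _ = _ := by simp
  refine (Finset.abs_sum_le_sum_abs _ _).trans ?_
  have key : ∀ j ∈ boxLt (fun _ : Fin d => 2 ^ M),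
      |PP (s + 1) (fun l => intervalPoint M (j l)) * ∏ l, XX M (N l) (g l) (j l)|
        ≤ if j ∈ C then 2 ^ (s + 1) / 2 ^ (2 * mm s + 1) else (0 : ℝ) := by
    intro j hj
    rw [mem_boxLt] at hj
    split_ifs with hjC
    · by_cases ha : agrD (2 * mm s + 1) (fun l => intervalPoint M (j l)) g
      · rw [PP_congr _ ha, hg]
        · simp; positivity
        · intro t ht
          have := mm_mono (Nat.lt_succ_iff.1 ht)
          omega
      · unfold agrD at ha
        push Not at ha
        obtain ⟨l, hl⟩ := ha
        rw [abs_mul, Finset.abs_prod, ← Finset.mul_prod_erase _ _ (Finset.mem_univ l)]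
        have h1 : |PP (s + 1) (fun l => intervalPoint M (j l))| ≤ 2 ^ (s + 1) := by
          rw [abs_of_nonneg (PP_nonneg _ _)]; exact PP_le _ _
        have h2 : |XX M (N l) (g l) (j l)| ≤ (2 ^ (2 * mm s + 1))⁻¹ := by
          refine (XX_small M (N l) _ (g l) (j l) hl).trans (le_of_eq ?_)
          rw [hM, mm_succ, two_mul (2 * mm s + 1), pow_add 2 (2 * mm s + 1) (2 * mm s + 1)]
          have : (2 : ℝ) ^ (2 * mm s + 1) ≠ 0 := by positivity
          rw [div_mul_eq_div_div, div_self this, one_div]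
        have h3 : ∏ x ∈ Finset.univ.erase l, |XX M (N x) (g x) (j x)| ≤ 1 := by
          apply Finset.prod_le_one
          · intros; positivity
          · intros; apply XX_le_one
        rw [div_eq_mul_inv]
        apply mul_le_mul h1 _ (by positivity) (by positivity)
        calc _ ≤ ((2 : ℝ) ^ (2 * mm s + 1))⁻¹ * 1 := by
              apply mul_le_mul h2 h3 (by positivity) (by positivity)
          _ = _ := by ring
    · rw [hC, Fintype.mem_piFinset] at hjC
      push Not at hjC
      obtain ⟨l, hl⟩ := hjC
      have : XX M (N l) (g l) (j l) = 0 := by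
        by_contra h
        apply hl
        have := XX_ne _ _ _ _ (hj l) h
        simpa using this
      rw [Finset.prod_eq_zero (Finset.mem_univ l) this]
      simp
  refine (Finset.sum_le_sum key).trans ?_
  rw [← Finset.sum_filter, Finset.sum_const, nsmul_eq_mul]
  gcongr
  refine le_trans ?_ hcard
  norm_cast
  apply Finset.card_le_card
  intro x hx
  exact (Finset.mem_filter.1 hx).2


lemma cnt_ex (k : ℕ) : ∃ s, k ≤ 2 * mm s := ⟨k, by have := le_mm k; omega⟩

/-- number of constraints on the first k digits -/
def cnt (k : ℕ) : ℕ := Nat.find (cnt_ex k)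

lemma cnt_spec (k : ℕ) : k ≤ 2 * mm (cnt k) := Nat.find_spec (cnt_ex k)

lemma lt_cnt {k t : ℕ} : t < cnt k ↔ 2 * mm t < k := by
  constructor
  · intro h
    have := Nat.find_min (cnt_ex k) h
    omega
  · intro h
    by_contra hc
    have h1 := mm_mono (not_lt.1 hc)
    have := cnt_spec k
    omega

lemma cnt_eq {k s : ℕ} (h : ∀ t, t < s ↔ 2 * mm t < k) : cnt k = s := by
  apply le_antisymm
  · by_contra hc
    have := lt_cnt.1 (not_le.1 hc)
    have := (h s).2 this
    omega
  · by_contra hc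
    have := (h (cnt k)).1 (not_le.1 hc)
    have := lt_cnt.2 this
    omega

lemma mm2_lt_iff {t s : ℕ} : 2 * mm t < 2 * mm s ↔ t < s := by
  constructor
  · intro h
    by_contra hc
    have := mm_mono (not_lt.1 hc)
    omega
  · intro h
    have := mm_lt h
    omega

lemma cnt_top (s : ℕ) : cnt (2 * mm s) = s := cnt_eq fun _ => mm2_lt_iff.symm

lemma cnt_top_succ (s : ℕ) : cnt (2 * mm s + 1) = s + 1 := by
  apply cnt_eq
  intro t
  constructor
  · intro h
    have := mm_mono (Nat.lt_succ_iff.1 h)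
    omega
  · intro h
    by_contra hc
    have := mm_lt (show s < t by omega)
    omega

lemma cnt_succ_of_ne {k : ℕ} (h : ∀ s, 2 * mm s ≠ k) : cnt (k + 1) = cnt k := by
  apply cnt_eq
  intro t
  rw [lt_cnt]
  have := h t
  omega

lemma PP_cnt_congr {d k : ℕ} {g h : GD d} (H : agrD k g h) : PP (cnt k) g = PP (cnt k) h :=
  PP_congr (fun t ht => by have := lt_cnt.1 ht; omega) H

lemma PP_ne_zero {d s : ℕ} {g : GD d} : PP s g ≠ 0 ↔ ∀ t < s, Rs t g = 1 := by
  unfold PP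
  rw [Finset.prod_ne_zero_iff]
  simp only [Finset.mem_range]
  refine forall₂_congr fun t _ => ?_
  rcases Rs_pm t g with h | h <;> rw [h] <;> norm_num

lemma Rs_factor {d : ℕ} (s : ℕ) (g h : GD d) (H : agrD (2 * mm s) g h) :
    Rs s h = (∏ l, sg (h l (2 * mm s))) * (∏ l, sg (g l (2 * mm s))) * Rs s g := by
  unfold Rs
  rw [Finset.prod_mul_distrib, Finset.prod_mul_distrib]
  have e : (∏ l, sg (g l (2 * mm s))) * (∏ l, sg (g l (2 * mm s))) = 1 := by
    rw [← Finset.prod_mul_distrib]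
    exact Finset.prod_eq_one fun l _ => sg_mul_self _
  have e2 : ∏ l, walsh (idx (mm s) (g l)) (shf (mm s) (g l))
      = ∏ l, walsh (idx (mm s) (h l)) (shf (mm s) (h l)) := by
    apply Finset.prod_congr rfl
    intro l _
    rw [idx_congr (agr_mono (by omega) (H l))]
    apply walsh_congr (idx_lt _ _)
    intro t ht
    exact H l _ (by omega)
  rw [e2]
  linear_combination (-(∏ l, sg (h l (2 * mm s))) *
    ∏ l, walsh (idx (mm s) (h l)) (shf (mm s) (h l))) * e

/-- child of rank k+1 -/
def chd {d : ℕ} (k : ℕ) (g : GD d) (σ : Fin d → Fin 2) : GD d :=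
  fun l => Function.update (g l) k ((σ l : ℕ) : ZMod 2)

lemma chd_agr {d : ℕ} (k : ℕ) (g : GD d) (σ : Fin d → Fin 2) : agrD k g (chd k g σ) := by
  intro l t ht
  simp [chd, Function.update_of_ne (show t ≠ k by omega)]

lemma idx_chd {d : ℕ} (k : ℕ) (g : GD d) (σ : Fin d → Fin 2) :
    (fun l => idx (k + 1) (chd k g σ l)) = fun l => 2 * idx k (g l) + (σ l : ℕ) := by
  funext l
  simp only [idx]
  rw [← idx_congr (chd_agr k g σ l)]
  congr 1
  simp only [chd, Function.update_self]
  generalize σ l = x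
  fin_cases x <;> simp

lemma sum_sg {d : ℕ} (hd : 0 < d) :
    ∑ σ : Fin d → Fin 2, ∏ l, sg (((σ l : ℕ) : ZMod 2)) = 0 := by
  have h := Finset.prod_univ_sum (ι := Fin d) (fun _ => (Finset.univ : Finset (Fin 2)))
    (fun _ x => sg (((x : ℕ) : ZMod 2)))
  rw [Fintype.piFinset_univ] at h
  rw [← h]
  apply Finset.prod_eq_zero (Finset.mem_univ ⟨0, hd⟩)
  rw [Fin.sum_univ_two]
  simp [sg]

lemma sum_Rs {d : ℕ} (hd : 0 < d) (s : ℕ) (g : GD d) :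
    ∑ σ : Fin d → Fin 2, Rs s (chd (2 * mm s) g σ) = 0 := by
  have : ∀ σ : Fin d → Fin 2, Rs s (chd (2 * mm s) g σ)
      = (∏ l, sg (((σ l : ℕ) : ZMod 2))) * ((∏ l, sg (g l (2 * mm s))) * Rs s g) := by
    intro σ
    rw [Rs_factor s g _ (chd_agr _ _ _)]
    simp only [chd, Function.update_self]
    ring
  simp_rw [this]
  rw [← Finset.sum_mul, sum_sg hd, zero_mul]

lemma step_ex {d : ℕ} (hd : 0 < d) (s : ℕ) (g : GD d) :
    ∃ h : GD d, agrD (2 * mm s) g h ∧ Rs s h = 1 := by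
  by_contra! hc
  have h := sum_Rs hd s g
  have : ∀ σ : Fin d → Fin 2, Rs s (chd (2 * mm s) g σ) = -1 := fun σ =>
    (Rs_pm _ _).resolve_left (hc _ (chd_agr _ _ _))
  simp_rw [this] at h
  simp at h

lemma exists_ext {d : ℕ} (hd : 0 < d) (s : ℕ) (g : GD d) (hg : ∀ t < s, Rs t g = 1) :
    ∃ h ∈ Fpi (idPerm d), agrD (2 * mm s) g h := by
  choose st hst1 hst2 using step_ex (d := d) hd
  let x : ℕ → GD d := fun i => Nat.rec g (fun i y => st (s + i) y) i
  have x0 : x 0 = g := rfl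
  have xs : ∀ i, x (i + 1) = st (s + i) (x i) := fun i => rfl
  have hag : ∀ i j, agrD (2 * mm (s + i)) (x i) (x (i + j)) := by
    intro i j
    induction j with
    | zero => intro l t _; rfl
    | succ j ih =>
      intro l t ht
      rw [ih l t ht, ← add_assoc, xs]
      apply hst1
      have := mm_mono (show s + i ≤ s + (i + j) by omega)
      omega
  have hR : ∀ i, ∀ t < s + i, Rs t (x i) = 1 := by
    intro i
    induction i with
    | zero => exact hg
    | succ i ih =>
      intro t ht
      rcases (show t < s + i ∨ t = s + i by omega) with h | h
      · rw [← Rs_congr (g := x i), ih t h]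
        have := mm_lt h
        exact agrD_mono (by omega) (hag i 1)
      · rw [h, xs, hst2]
  have hlim : ∀ i, agrD (2 * mm (s + i)) (x i) (fun l t => x (t + 1) l t) := by
    intro i l t ht
    rcases le_total i (t + 1) with h | h
    · obtain ⟨j, hj⟩ := Nat.exists_eq_add_of_le h
      have := hag i j l t ht
      rw [this, ← hj]
    · obtain ⟨j, hj⟩ := Nat.exists_eq_add_of_le h
      have := hag (t + 1) j l t (by have := le_mm (s + (t + 1)); omega)
      rw [hj, ← this]
  refine ⟨fun l t => x (t + 1) l t, ?_, hlim 0⟩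
  rw [mem_Fpi]
  intro t
  rw [← Rs_congr (g := x (t + 1)), hR (t + 1) t (by omega)]
  refine agrD_mono ?_ (hlim (t + 1))
  have := mm_lt (show t < s + (t + 1) by omega)
  omega

lemma mem_cube_idx {d : ℕ} (k : ℕ) (g h : GD d) :
    h ∈ dyadicCube k (fun l => idx k (g l)) ↔ agrD k h g := by
  unfold dyadicCube agrD
  simp only [Set.mem_ofPred_eq]
  exact forall_congr' fun l => mem_int_idx _ _ _

lemma meets {d : ℕ} (hd : 0 < d) (k : ℕ) (g : GD d) :
    (dyadicCube k (fun l => idx k (g l)) ∩ Fpi (idPerm d)).Nonempty ↔ PP (cnt k) g ≠ 0 := by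
  constructor
  · rintro ⟨h, h1, h2⟩
    rw [mem_cube_idx] at h1
    rw [← PP_cnt_congr h1, PP_ne_zero]
    intro t _
    exact (mem_Fpi h).1 h2 t
  · intro h
    obtain ⟨x, hx, ha⟩ := exists_ext hd (cnt k) g (PP_ne_zero.1 h)
    refine ⟨x, ?_, hx⟩
    rw [mem_cube_idx]
    intro l t ht
    exact (ha l t (lt_of_lt_of_le ht (cnt_spec k))).symm

lemma tau_formula {d : ℕ} (hd : 0 < d) (τ : ℕ → (Fin d → ℕ) → ℂ)
    (hτ : IsTauOf (Fpi (idPerm d)) τ) (k : ℕ) (g : GD d) :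
    τ k (fun l => idx k (g l)) = ((PP (cnt k) g / 2 ^ (k * d) : ℝ) : ℂ) := by
  obtain ⟨_, h0, hz, hdiv⟩ := hτ
  induction k generalizing g with
  | zero =>
    have : cnt 0 = 0 := by have := cnt_top 0; rwa [mm_zero] at this
    simp [idx, this, PP, h0]
  | succ k ih =>
    have hσ : ∃ σ : Fin d → Fin 2, agrD (k + 1) g (chd k g σ) := by
      refine ⟨fun l => if g l k = 1 then 1 else 0, ?_⟩
      intro l t ht
      rcases Nat.lt_succ_iff_lt_or_eq.1 ht with h | h
      · exact chd_agr _ _ _ l t h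
      · subst h
        rcases zmod2_cases (g l t) with e | e <;> simp [chd, e]
    by_cases hP : PP (cnt k) g = 0
    · have hP' : PP (cnt (k + 1)) g = 0 := by
        by_contra h
        have h := PP_ne_zero.1 h
        apply (not_not.2 hP)
        apply PP_ne_zero.2
        intro t ht
        apply h
        rw [lt_cnt] at *
        omega
      rw [(hz (k + 1) _ (fun l => idx_lt _ _)).2, hP']
      · simp
      · rw [← Set.not_nonempty_iff_eq_empty, meets hd]
        simpa using hP'
    · obtain ⟨σ, hσ⟩ := hσ
      have hm : (dyadicCube k (fun l => idx k (g l)) ∩ Fpi (idPerm d)).Nonempty :=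
        (meets hd k g).2 hP
      have key := hdiv k (fun l => idx k (g l)) (fun l => idx_lt _ _) hm σ
      have hidx : (fun l => 2 * idx k (g l) + (σ l : ℕ)) = fun l => idx (k + 1) (g l) := by
        rw [← idx_chd]
        funext l
        rw [idx_congr (hσ l)]
      have hch : ∀ σ' : Fin d → Fin 2, (dyadicCube (k + 1) (fun l => 2 * idx k (g l) + (σ' l : ℕ))
          ∩ Fpi (idPerm d)).Nonempty ↔ PP (cnt (k + 1)) (chd k g σ') ≠ 0 := by
        intro σ'
        rw [← idx_chd, meets hd]
      simp only [hch, ← PP_cnt_congr hσ] at key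
      rw [hidx] at key
      rw [key, ih]
      by_cases hs : ∃ s, 2 * mm s = k
      · obtain ⟨s, rfl⟩ := hs
        simp only [cnt_top, cnt_top_succ] at *
        have hPP : ∀ σ', PP (s + 1) (chd (2 * mm s) g σ')
            = PP s g * (1 + Rs s (chd (2 * mm s) g σ')) := by
          intro σ'
          unfold PP
          rw [Finset.prod_range_succ]
          congr 1
          exact (PP_congr (fun t ht => by have := mm_lt ht; omega) (chd_agr _ _ _)).symm
        have hcard : ((Finset.univ.filter fun σ' : Fin d → Fin 2 =>
            PP (s + 1) (chd (2 * mm s) g σ') ≠ 0).card : ℝ) = 2 ^ d / 2 := by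
          rw [← Finset.sum_boole]
          have : ∀ σ' : Fin d → Fin 2, (if PP (s + 1) (chd (2 * mm s) g σ') ≠ 0 then (1 : ℝ) else 0)
              = 1 / 2 + (1 / 2) * Rs s (chd (2 * mm s) g σ') := by
            intro σ'
            rw [hPP]
            rcases Rs_pm s (chd (2 * mm s) g σ') with h | h <;> rw [h]
            · rw [if_pos (mul_ne_zero hP (by norm_num))]; norm_num
            · rw [if_neg (by norm_num)]; norm_num
          simp_rw [this]
          rw [Finset.sum_add_distrib, ← Finset.mul_sum, sum_Rs hd]
          simp
          ring
        have hcard' : ((Finset.univ.filter fun σ' : Fin d → Fin 2 =>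
            PP (s + 1) (chd (2 * mm s) g σ') ≠ 0).card : ℂ) = ((2 ^ d / 2 : ℝ) : ℂ) := by
          rw [← hcard]; push_cast; rfl
        have hg : PP (s + 1) g = PP s g * (1 + Rs s g) := by
          unfold PP
          rw [Finset.prod_range_succ]
        rw [hcard', hg]
        rcases Rs_pm s g with h | h <;> rw [h]
        · rw [if_pos (mul_ne_zero hP (by norm_num))]
          rw [← Complex.ofReal_div]
          congr 1
          rw [add_mul, pow_add, one_mul]
          field_simp
          norm_num
        · rw [if_neg (by norm_num)]
          norm_num
      · push Not at hs
        have hc := cnt_succ_of_ne hs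
        rw [hc] at *
        rw [if_pos hP]
        have hall : ∀ σ', PP (cnt k) (chd k g σ') ≠ 0 := by
          intro σ'
          rwa [← PP_cnt_congr (chd_agr k g σ')]
        simp only [hall, not_false_eq_true, Finset.filter_true, ne_eq, Finset.card_univ]
        simp
        rw [add_mul, pow_add, one_mul, div_div]


lemma orthD_n {d : ℕ} (k : ℕ) (g h : GD d) :
    ∑ n ∈ boxLt (fun _ : Fin d => 2 ^ k), walshD n g * walshD n h
      = if agrD k g h then 2 ^ (k * d) else 0 := by
  have e := Finset.prod_univ_sum (ι := Fin d) (fun _ => Finset.range (2 ^ k))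
    (fun l n => walsh n (g l) * walsh n (h l))
  unfold boxLt walshD
  simp_rw [← Finset.prod_mul_distrib]
  rw [← e]
  simp_rw [dir_full]
  split_ifs with H
  · rw [Finset.prod_congr rfl (g := fun _ => (2 : ℝ) ^ k)]
    · simp [pow_mul]
    · intro l _; rw [if_pos (H l)]
  · unfold agrD at H
    push Not at H
    obtain ⟨l, hl⟩ := H
    exact Finset.prod_eq_zero (Finset.mem_univ l) (if_neg hl)

lemma agr_pt {k n n' : ℕ} (hn : n < 2 ^ k) (hn' : n' < 2 ^ k) :
    agr k (intervalPoint k n) (intervalPoint k n') ↔ n = n' := by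
  constructor
  · intro h
    have := idx_congr h
    rwa [idx_pt hn, idx_pt hn'] at this
  · rintro rfl; intro t _; rfl

lemma orthD_m {d : ℕ} (k : ℕ) (n n' : Fin d → ℕ) (hn : ∀ l, n l < 2 ^ k) (hn' : ∀ l, n' l < 2 ^ k) :
    ∑ m ∈ boxLt (fun _ : Fin d => 2 ^ k), walshD n (cubePoint k m) * walshD n' (cubePoint k m)
      = if n = n' then 2 ^ (k * d) else 0 := by
  have : ∀ m ∈ boxLt (fun _ : Fin d => 2 ^ k),
      walshD n (cubePoint k m) * walshD n' (cubePoint k m)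
      = walshD m (cubePoint k n) * walshD m (cubePoint k n') := by
    intro m hm
    rw [mem_boxLt] at hm
    unfold walshD cubePoint
    congr 1
    · exact Finset.prod_congr rfl fun l _ => walshVal_symm (hn l) (hm l)
    · exact Finset.prod_congr rfl fun l _ => walshVal_symm (hn' l) (hm l)
  rw [Finset.sum_congr rfl this, orthD_n]
  have e : agrD k (cubePoint k n) (cubePoint k n') ↔ n = n' := by
    rw [funext_iff]
    exact forall_congr' fun l => agr_pt (hn l) (hn' l)
  simp only [e]

lemma tau_pt {d : ℕ} (hd : 0 < d) (τ : ℕ → (Fin d → ℕ) → ℂ)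
    (hτ : IsTauOf (Fpi (idPerm d)) τ) (k : ℕ) (m : Fin d → ℕ) (hm : ∀ l, m l < 2 ^ k) :
    τ k m = ((PP (cnt k) (cubePoint k m) / 2 ^ (k * d) : ℝ) : ℂ) := by
  rw [← tau_formula hd τ hτ]
  congr 1
  funext l
  exact (idx_pt (hm l)).symm

lemma sum_full {d : ℕ} (hd : 0 < d) (τ : ℕ → (Fin d → ℕ) → ℂ)
    (hτ : IsTauOf (Fpi (idPerm d)) τ) (a : (Fin d → ℕ) → ℂ)
    (ha : ∀ (n : Fin d → ℕ) (k : ℕ), (∀ l, n l < 2 ^ k) → a n = fourierCoeffAt τ n k)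
    (k : ℕ) (g : GD d) :
    ∑ n ∈ boxLt (fun _ : Fin d => 2 ^ k), a n * (walshD n g : ℂ) = ((PP (cnt k) g : ℝ) : ℂ) := by
  have h1 : ∑ n ∈ boxLt (fun _ : Fin d => 2 ^ k), a n * (walshD n g : ℂ)
      = ∑ n ∈ boxLt (fun _ : Fin d => 2 ^ k), ∑ m ∈ boxLt (fun _ : Fin d => 2 ^ k),
        τ k m * ((walshD n (cubePoint k m) * walshD n g : ℝ) : ℂ) := by
    apply Finset.sum_congr rfl
    intro n hn
    rw [mem_boxLt] at hn
    rw [ha n k hn]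
    unfold fourierCoeffAt walshValD
    rw [Finset.sum_mul]
    apply Finset.sum_congr rfl
    intro m _
    push_cast; ring
  rw [h1, Finset.sum_comm]
  simp_rw [← Finset.mul_sum, ← Complex.ofReal_sum, orthD_n]
  rw [Finset.sum_eq_single (fun l => idx k (g l))]
  · rw [if_pos, tau_formula hd τ hτ]
    · rw [← Complex.ofReal_mul]; congr 1; field_simp
    · intro l; exact pt_agr _ _
  · intro m hm hne
    rw [mem_boxLt] at hm
    rw [if_neg]
    · simp
    · intro h
      apply hne
      funext l
      rw [← idx_congr (h l)]
      exact (idx_pt (hm l)).symm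
  · intro h
    exfalso; apply h
    rw [mem_boxLt]
    intro l; exact idx_lt _ _

lemma coef {d : ℕ} (hd : 0 < d) (τ : ℕ → (Fin d → ℕ) → ℂ)
    (hτ : IsTauOf (Fpi (idPerm d)) τ) (a : (Fin d → ℕ) → ℂ)
    (ha : ∀ (n : Fin d → ℕ) (k : ℕ), (∀ l, n l < 2 ^ k) → a n = fourierCoeffAt τ n k)
    (s : ℕ) (n : Fin d → ℕ) (hn : ∀ l, n l < 2 ^ (2 * mm s + 1)) :
    a n = (((if n = (fun _ => 0) then 1 else 0) +
      ∑ t ∈ Finset.range (s + 1), ∑ n' ∈ boxLt (fun _ : Fin d => 2 ^ (2 * mm t)),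
        bet t n' * (if n = (fun l => n' l + 2 ^ (2 * mm t)) then 1 else 0) : ℝ) : ℂ) := by
  set k := 2 * mm s + 1 with hk
  rw [ha n k hn]
  unfold fourierCoeffAt walshValD
  have h1 : ∑ m ∈ boxLt (fun _ : Fin d => 2 ^ k), (walshD n (cubePoint k m) : ℂ) * τ k m
      = ((∑ m ∈ boxLt (fun _ : Fin d => 2 ^ k),
          (2 ^ (k * d))⁻¹ * (walshD n (cubePoint k m) * PP (s + 1) (cubePoint k m)) : ℝ) : ℂ) := by
    rw [Complex.ofReal_sum]
    apply Finset.sum_congr rfl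
    intro m hm
    rw [mem_boxLt] at hm
    rw [tau_pt hd τ hτ k m hm, hk, cnt_top_succ]
    push_cast
    ring
  rw [h1]
  congr 1
  rw [← Finset.mul_sum, inv_mul_eq_iff_eq_mul₀ (by positivity)]
  have h2 : ∀ m ∈ boxLt (fun _ : Fin d => 2 ^ k),
      walshD n (cubePoint k m) * PP (s + 1) (cubePoint k m)
      = walshD n (cubePoint k m) * walshD (fun _ => 0) (cubePoint k m)
      + ∑ t ∈ Finset.range (s + 1), ∑ n' ∈ boxLt (fun _ : Fin d => 2 ^ (2 * mm t)),
        bet t n' * (walshD n (cubePoint k m)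
          * walshD (fun l => n' l + 2 ^ (2 * mm t)) (cubePoint k m)) := by
    intro m _
    rw [PP_expand, mul_add, Finset.mul_sum]
    congr 1
    · simp [walshD, walsh_zero]
    · apply Finset.sum_congr rfl
      intro t _
      rw [Finset.mul_sum]
      apply Finset.sum_congr rfl
      intro n' _
      ring
  rw [Finset.sum_congr rfl h2, Finset.sum_add_distrib,
    orthD_m k n _ hn (fun _ => by positivity), mul_add]
  congr 1
  · simp
  · rw [Finset.sum_comm, Finset.mul_sum]
    apply Finset.sum_congr rfl
    intro t ht
    rw [Finset.sum_comm, Finset.mul_sum]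
    apply Finset.sum_congr rfl
    intro n' hn'
    rw [mem_boxLt] at hn'
    rw [← Finset.mul_sum, orthD_m k n _ hn]
    · split_ifs <;> ring
    · intro l
      have h3 := mm_mono (Nat.lt_succ_iff.1 (Finset.mem_range.1 ht))
      have h4 : 2 ^ (2 * mm t) ≤ 2 ^ (2 * mm s) := Nat.pow_le_pow_right (by norm_num) (by omega)
      have := hn' l
      rw [hk, pow_succ]
      omega

lemma coef_block {d : ℕ} (hd : 0 < d) (τ : ℕ → (Fin d → ℕ) → ℂ)
    (hτ : IsTauOf (Fpi (idPerm d)) τ) (a : (Fin d → ℕ) → ℂ)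
    (ha : ∀ (n : Fin d → ℕ) (k : ℕ), (∀ l, n l < 2 ^ k) → a n = fourierCoeffAt τ n k)
    (s : ℕ) (n : Fin d → ℕ) (hn : ∀ l, n l < 2 ^ (2 * mm s)) :
    a (fun l => n l + 2 ^ (2 * mm s)) = ((bet s n : ℝ) : ℂ) := by
  rw [coef hd τ hτ a ha s]
  · congr 1
    have l0 : Fin d := ⟨0, hd⟩
    have hp : 0 < 2 ^ (2 * mm s) := by positivity
    rw [if_neg, zero_add, Finset.sum_eq_single s, Finset.sum_eq_single n]
    · simp
    · intro b _ hb
      rw [if_neg]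
      · simp
      · intro h
        apply hb
        funext l
        have := congrFun h l
        simp at this
        exact this.symm
    · intro h
      exact absurd ((mem_boxLt _ _).2 hn) h
    · intro t ht hts
      apply Finset.sum_eq_zero
      intro n' hn'
      rw [if_neg, mul_zero]
      intro h
      have h1 := congrFun h l0
      have h2 := (mem_boxLt _ _).1 hn' l0
      have h3 := mm_lt (show t < s by have := Finset.mem_range.1 ht; omega)
      have h4 : 2 ^ (2 * mm t + 1) ≤ 2 ^ (2 * mm s) := Nat.pow_le_pow_right (by norm_num) (by omega)
      rw [pow_succ] at h4
      omega
    · simp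
    · intro h
      have := congrFun h l0
      simp at this
  · intro l
    have := hn l
    rw [pow_succ]; omega

lemma coef_supp {d : ℕ} (hd : 0 < d) (τ : ℕ → (Fin d → ℕ) → ℂ)
    (hτ : IsTauOf (Fpi (idPerm d)) τ) (a : (Fin d → ℕ) → ℂ)
    (ha : ∀ (n : Fin d → ℕ) (k : ℕ), (∀ l, n l < 2 ^ k) → a n = fourierCoeffAt τ n k)
    (n : Fin d → ℕ) (h : a n ≠ 0) :
    n = (fun _ => 0) ∨ ∃ t, ∃ n' : Fin d → ℕ, (∀ l, n' l < 2 ^ (2 * mm t)) ∧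
      n = fun l => n' l + 2 ^ (2 * mm t) := by
  by_contra! hc
  apply h
  obtain ⟨s, hs⟩ : ∃ s, ∀ l, n l < 2 ^ (2 * mm s + 1) := by
    refine ⟨∑ l, n l, fun l => ?_⟩
    have h1 : n l ≤ ∑ l, n l := Finset.single_le_sum (fun _ _ => Nat.zero_le _) (Finset.mem_univ l)
    have h2 := le_mm (∑ l, n l)
    calc n l < 2 ^ n l := Nat.lt_two_pow_self
      _ ≤ _ := Nat.pow_le_pow_right (by norm_num) (by omega)
  rw [coef hd τ hτ a ha s n hs, if_neg hc.1, zero_add, Finset.sum_eq_zero]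
  · simp
  · intro t _
    apply Finset.sum_eq_zero
    intro n' hn'
    rw [if_neg (hc.2 t n' ((mem_boxLt _ _).1 hn')), mul_zero]

lemma bound_tendsto (d : ℕ) :
    Tendsto (fun s : ℕ => (2 : ℝ) ^ d * (2 ^ (s + 1) / 2 ^ (2 * mm s + 1))) atTop (𝓝 0) := by
  have h1 : Tendsto (fun s : ℕ => (2 : ℝ) ^ d * (1 / 2) ^ s) atTop (𝓝 0) := by
    have := (tendsto_pow_atTop_nhds_zero_of_lt_one (r := (1 / 2 : ℝ)) (by norm_num)
      (by norm_num)).const_mul ((2 : ℝ) ^ d)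
    simpa using this
  apply squeeze_zero (fun s => by positivity) _ h1
  intro s
  gcongr
  rw [div_le_iff₀ (by positivity), one_div, inv_pow, inv_mul_eq_div, le_div_iff₀ (by positivity),
    ← pow_add]
  have := le_mm s
  exact pow_le_pow_right₀ (by norm_num) (by omega)

lemma rect_bound {d : ℕ} (hd : 0 < d) (τ : ℕ → (Fin d → ℕ) → ℂ)
    (hτ : IsTauOf (Fpi (idPerm d)) τ) (a : (Fin d → ℕ) → ℂ)
    (ha : ∀ (n : Fin d → ℕ) (k : ℕ), (∀ l, n l < 2 ^ k) → a n = fourierCoeffAt τ n k)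
    (g : GD d) (s : ℕ) (hs : PP (s + 1) g = 0) (N : Fin d → ℕ)
    (hN1 : ∀ l, 2 ^ (2 * mm (s + 1)) ≤ N l) (hN2 : ∃ l, N l ≤ 2 ^ (2 * mm (s + 2))) :
    ‖walshPartialSum a N g‖ ≤ 2 ^ d * (2 ^ (s + 1) / 2 ^ (2 * mm s + 1)) := by
  set k := 2 * mm (s + 1) with hk
  have hsub : boxLt (fun _ : Fin d => 2 ^ k) ⊆ boxLt N := by
    intro n hn
    rw [mem_boxLt] at *
    intro l
    exact lt_of_lt_of_le (hn l) (hN1 l)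
  have h1 := sum_full hd τ hτ a ha k g
  rw [hk, cnt_top, hs] at h1
  unfold walshPartialSum
  rw [← Finset.sum_sdiff hsub, h1, Complex.ofReal_zero, add_zero]
  set N' : Fin d → ℕ := fun l => min (2 ^ k) (N l - 2 ^ k) with hN'
  have h2 : ∑ n ∈ boxLt N', a (fun l => n l + 2 ^ k) * (walshD (fun l => n l + 2 ^ k) g : ℂ)
      = ∑ n ∈ boxLt N \ boxLt (fun _ : Fin d => 2 ^ k), a n * (walshD n g : ℂ) := by
    apply Finset.sum_of_injOn (fun n l => n l + 2 ^ k)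
    · intro n _ n' _ h
      funext l
      have := congrFun h l
      simpa using this
    · intro n hn
      have hn := (mem_boxLt _ _).1 (Finset.mem_coe.1 hn)
      rw [Finset.mem_coe, Finset.mem_sdiff, mem_boxLt, mem_boxLt]
      constructor
      · intro l
        have := hn l
        have h9 := hN1 l
        simp only [hN'] at this
        show n l + 2 ^ k < N l
        omega
      · intro h
        have : n ⟨0, hd⟩ + 2 ^ k < 2 ^ k := h ⟨0, hd⟩
        omega
    · intro n hn hni
      by_cases h0 : a n = 0
      · rw [h0, zero_mul]
      · exfalso
        rw [Finset.mem_sdiff, mem_boxLt, mem_boxLt] at hn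
        rcases coef_supp hd τ hτ a ha n h0 with h | ⟨t, n', hn', h⟩
        · apply hn.2
          intro l
          rw [h]; positivity
        · have ht : t = s + 1 := by
            rcases lt_trichotomy t (s + 1) with ht | ht | ht
            · exfalso
              apply hn.2
              intro l
              have h3 := mm_lt ht
              have h4 : 2 ^ (2 * mm t + 1) ≤ 2 ^ k := Nat.pow_le_pow_right (by norm_num) (by omega)
              have := hn' l
              rw [h]
              rw [pow_succ] at h4
              simp only
              omega
            · exact ht
            · exfalso
              obtain ⟨l, hl⟩ := hN2
              have h3 := mm_mono (show s + 2 ≤ t by omega)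
              have h4 : 2 ^ (2 * mm (s + 2)) ≤ 2 ^ (2 * mm t) :=
                Nat.pow_le_pow_right (by norm_num) (by omega)
              have h5 := hn.1 l
              rw [h] at h5
              simp only at h5
              omega
          subst ht
          apply hni
          refine ⟨n', ?_, h.symm⟩
          rw [Finset.mem_coe, mem_boxLt]
          intro l
          have h5 := hn.1 l
          have h6 := hn' l
          rw [h] at h5
          have h5 : n' l + 2 ^ k < N l := h5
          have h6 : n' l < 2 ^ k := h6
          show n' l < min (2 ^ k) (N l - 2 ^ k)
          omega
    · intros; rfl
  rw [← h2]
  have h3 : ∑ n ∈ boxLt N', a (fun l => n l + 2 ^ k) * (walshD (fun l => n l + 2 ^ k) g : ℂ)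
      = (((∏ l, sg (g l k)) * ∑ n ∈ boxLt N', bet (s + 1) n * walshD n g : ℝ) : ℂ) := by
    rw [Finset.mul_sum, Complex.ofReal_sum]
    apply Finset.sum_congr rfl
    intro n hn
    have hn' : ∀ l, n l < 2 ^ k := by
      intro l
      have := (mem_boxLt _ _).1 hn l
      simp only [hN'] at this
      omega
    rw [coef_block hd τ hτ a ha (s + 1) n hn', walshD_top _ _ hn']
    push_cast
    ring
  rw [h3, Complex.norm_real, Real.norm_eq_abs, abs_mul, Finset.abs_prod,
    Finset.prod_eq_one (fun l _ => sg_abs _), one_mul]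
  exact T_bound s N' (fun l => min_le_left _ _) g hs

lemma rect_conv {d : ℕ} (hd : 0 < d) (τ : ℕ → (Fin d → ℕ) → ℂ)
    (hτ : IsTauOf (Fpi (idPerm d)) τ) (a : (Fin d → ℕ) → ℂ)
    (ha : ∀ (n : Fin d → ℕ) (k : ℕ), (∀ l, n l < 2 ^ k) → a n = fourierCoeffAt τ n k)
    (g : GD d) (hg : g ∉ Fpi (idPerm d)) : ConvergesOverRectangles a g 0 := by
  rw [mem_Fpi] at hg
  push Not at hg
  obtain ⟨s0, hs0⟩ := hg
  unfold ConvergesOverRectangles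
  rw [Metric.tendsto_atTop]
  intro ε hε
  obtain ⟨s1, hs1⟩ := (Metric.tendsto_atTop.1 (bound_tendsto d)) ε hε
  refine ⟨fun _ => 2 ^ (2 * mm (max s0 s1 + 1)), fun N hN => ?_⟩
  have hex : ∃ s, ∃ l, N l < 2 ^ (2 * mm (s + 1)) := by
    refine ⟨N ⟨0, hd⟩, ⟨0, hd⟩, ?_⟩
    have h2 := le_mm (N ⟨0, hd⟩ + 1)
    calc N ⟨0, hd⟩ < 2 ^ N ⟨0, hd⟩ := Nat.lt_two_pow_self
      _ ≤ _ := Nat.pow_le_pow_right (by norm_num) (by omega)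
  have hfs := Nat.find_spec hex
  have hmin := fun t => Nat.find_min hex (m := t)
  generalize Nat.find hex = S at hfs hmin
  have hS : max s0 s1 < S := by
    by_contra hc
    obtain ⟨l, hl⟩ := hfs
    have h1 := hN l
    have h3 := mm_mono (show S + 1 ≤ max s0 s1 + 1 by omega)
    have h4 : 2 ^ (2 * mm (S + 1)) ≤ 2 ^ (2 * mm (max s0 s1 + 1)) :=
                Nat.pow_le_pow_right (by norm_num) (by omega)
    simp only at h1
    omega
  obtain ⟨s, rfl⟩ : ∃ s, S = s + 1 := ⟨S - 1, by omega⟩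
  have hb := hs1 s (by omega)
  rw [Real.dist_eq, sub_zero, abs_of_nonneg (by positivity)] at hb
  rw [dist_zero_right]
  refine lt_of_le_of_lt (rect_bound hd τ hτ a ha g s ?_ N ?_ ?_) hb
  · by_contra h
    exact hs0 (PP_ne_zero.1 h s0 (by omega))
  · have := hmin s (by omega)
    push Not at this
    exact this
  · obtain ⟨l, hl⟩ := hfs
    exact ⟨l, hl.le⟩

lemma supp_ratio {d : ℕ} (hd : 0 < d) (τ : ℕ → (Fin d → ℕ) → ℂ)
    (hτ : IsTauOf (Fpi (idPerm d)) τ) (a : (Fin d → ℕ) → ℂ)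
    (ha : ∀ (n : Fin d → ℕ) (k : ℕ), (∀ l, n l < 2 ^ k) → a n = fourierCoeffAt τ n k)
    (n : Fin d → ℕ) (h : a n ≠ 0) (i j : Fin d) : n i ≤ 2 * n j := by
  rcases coef_supp hd τ hτ a ha n h with h | ⟨t, n', hn', h⟩
  · simp [h]
  · have := hn' i
    rw [h]
    simp only
    omega


/-- sum over the variables in A, the other ones being fixed -/
def HA {d : ℕ} (f : (Fin d → ℕ) → ℂ) (A : Finset (Fin d)) (n : Fin d → ℕ) : ℂ :=
  ∑ᶠ x ∈ {x : Fin d → ℕ | ∀ i, i ∉ A → x i = n i}, f x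

lemma HA_eq {d : ℕ} (f : (Fin d → ℕ) → ℂ) (hf : ∀ x, f x ≠ 0 → ∀ i j, x i ≤ 2 * x j)
    (A : Finset (Fin d)) (n : Fin d → ℕ) (j : Fin d) (hj : j ∉ A) (B : Fin d → ℕ)
    (hB : ∀ l, 2 * n j < B l) :
    HA f A n = ∑ x ∈ boxLt B, if ∀ i, i ∉ A → x i = n i then f x else 0 := by
  rw [← Finset.sum_filter]
  apply finsum_mem_eq_sum_of_inter_support_eq
  ext x
  simp only [Set.mem_inter_iff, Set.mem_ofPred_eq, Function.mem_support, Finset.coe_filter,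
    mem_boxLt]
  constructor
  · rintro ⟨h1, h2⟩
    refine ⟨⟨fun l => ?_, h1⟩, h2⟩
    have h3 := hf x h2 l j
    rw [h1 j hj] at h3
    exact lt_of_le_of_lt h3 (hB l)
  · rintro ⟨⟨_, h1⟩, h2⟩
    exact ⟨h1, h2⟩

lemma HA_step {d : ℕ} (f : (Fin d → ℕ) → ℂ) (hf : ∀ x, f x ≠ 0 → ∀ i j, x i ≤ 2 * x j)
    (A : Finset (Fin d)) (n : Fin d → ℕ) (j : Fin d) (hj : j ∉ A) (T : ℕ) :
    ∑ t ∈ Finset.range T, HA f A (Function.update n j t)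
      = ∑ x ∈ boxLt (fun _ : Fin d => 2 * T),
          if x j < T ∧ ∀ i, i ∉ insert j A → x i = n i then f x else 0 := by
  have h1 : ∀ t ∈ Finset.range T, HA f A (Function.update n j t)
      = ∑ x ∈ boxLt (fun _ : Fin d => 2 * T),
          if x j = t then (if ∀ i, i ∉ insert j A → x i = n i then f x else 0) else 0 := by
    intro t ht
    rw [Finset.mem_range] at ht
    rw [HA_eq f hf A _ j hj (fun _ => 2 * T) (by intro l; simp; omega)]
    apply Finset.sum_congr rfl
    intro x _
    have e : (∀ i, i ∉ A → x i = Function.update n j t i) ↔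
        (x j = t ∧ ∀ i, i ∉ insert j A → x i = n i) := by
      constructor
      · intro h
        refine ⟨by simpa using h j hj, fun i hi => ?_⟩
        simp only [Finset.mem_insert, not_or] at hi
        have := h i hi.2
        rwa [Function.update_of_ne hi.1] at this
      · rintro ⟨h1, h2⟩ i hi
        by_cases hij : i = j
        · subst hij; simpa using h1
        · rw [Function.update_of_ne hij]
          apply h2
          simp [hij, hi]
    simp only [e, ite_and]
  rw [Finset.sum_congr rfl h1, Finset.sum_comm]
  apply Finset.sum_congr rfl
  intro x _
  rw [Finset.sum_ite_eq]
  simp only [Finset.mem_range, ite_and]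

lemma iter_aux {d : ℕ} (f : (Fin d → ℕ) → ℂ) (hf : ∀ x, f x ≠ 0 → ∀ i j, x i ≤ 2 * x j)
    (hS : Tendsto (fun N : Fin d → ℕ => ∑ x ∈ boxLt N, f x) atTop (𝓝 0)) :
    ∀ (l : List (Fin d)) (A : Finset (Fin d)), l ≠ [] → l.Nodup → (∀ j, j ∈ l ↔ j ∉ A) →
      IterConvAux l (HA f A) (fun _ => 0) := by
  intro l
  induction l with
  | nil => intro A h; exact absurd rfl h
  | cons j rest ih =>
    intro A _ hnd hA
    have hj : j ∉ A := (hA j).1 (by simp)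
    rw [List.nodup_cons] at hnd
    have hA' : ∀ i, i ∈ rest ↔ i ∉ insert j A := by
      intro i
      have := hA i
      simp only [List.mem_cons, Finset.mem_insert, not_or] at *
      constructor
      · intro h
        exact ⟨fun e => hnd.1 (e ▸ h), this.1 (Or.inr h)⟩
      · rintro ⟨h1, h2⟩
        exact (this.2 h2).resolve_left h1
    by_cases hr : rest = []
    · subst hr
      refine ⟨fun _ => 0, fun n => ?_, rfl⟩
      simp only [HA_step f hf A n j hj]
      have huniv : ∀ i, i ∈ insert j A := by
        intro i
        by_contra h
        simpa using (hA' i).2 h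
      have e : ∀ T : ℕ, ∑ x ∈ boxLt (fun _ : Fin d => 2 * T),
          (if x j < T ∧ ∀ i, i ∉ insert j A → x i = n i then f x else 0)
          = ∑ x ∈ boxLt (Function.update (fun _ : Fin d => 2 * T) j T), f x := by
        intro T
        rw [← Finset.sum_filter]
        congr 1
        ext x
        simp only [Finset.mem_filter, mem_boxLt]
        constructor
        · rintro ⟨h1, h2, _⟩ i
          by_cases hij : i = j
          · subst hij; simpa using h2
          · rw [Function.update_of_ne hij]; exact h1 i
        · intro h
          have hjj : x j < T := by simpa using h j
          refine ⟨fun i => ?_, hjj, fun i hi => absurd (huniv i) hi⟩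
          by_cases hij : i = j
          · subst hij; omega
          · have := h i
            rwa [Function.update_of_ne hij] at this
      simp only [e]
      refine hS.comp ?_
      rw [tendsto_atTop]
      intro b
      filter_upwards [eventually_ge_atTop (∑ i, b i)] with T hT
      intro i
      have h1 : b i ≤ ∑ l, b l :=
        Finset.single_le_sum (fun _ _ => Nat.zero_le _) (Finset.mem_univ i)
      by_cases hij : i = j
      · subst hij; simp; omega
      · rw [Function.update_of_ne hij]; show b i ≤ 2 * T; omega
    · refine ⟨HA f (insert j A), fun n => ?_, ih _ hr hnd.2 hA'⟩
      obtain ⟨i, hi⟩ := List.exists_mem_of_ne_nil _ hr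
      have hi' := (hA' i).1 hi
      apply tendsto_const_nhds.congr'
      filter_upwards [eventually_gt_atTop (2 * n i)] with T hT
      rw [HA_step f hf A n j hj, HA_eq f hf _ n i hi' (fun _ => 2 * T) (by intro l; omega)]
      apply Finset.sum_congr rfl
      intro x _
      by_cases h0 : f x = 0
      · simp [h0]
      · have : (x j < T ∧ ∀ i, i ∉ insert j A → x i = n i) ↔ ∀ i, i ∉ insert j A → x i = n i := by
          constructor
          · exact fun h => h.2
          · intro h
            refine ⟨?_, h⟩
            have h3 := hf x h0 j i
            rw [h i hi'] at h3
            omega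
        simp only [this]

lemma iter_conv {d : ℕ} (hd : 0 < d) (f : (Fin d → ℕ) → ℂ)
    (hf : ∀ x, f x ≠ 0 → ∀ i j, x i ≤ 2 * x j)
    (hS : Tendsto (fun N : Fin d → ℕ => ∑ x ∈ boxLt N, f x) atTop (𝓝 0))
    (l : List (Fin d)) (hnd : l.Nodup) (hl : ∀ j, j ∈ l) : IterConverges l f 0 := by
  refine ⟨fun _ => 0, ?_, fun _ => rfl⟩
  have h := iter_aux f hf hS l ∅ (List.ne_nil_of_mem (hl ⟨0, hd⟩)) hnd (by simp [hl])
  have e : HA f ∅ = f := by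
    funext n
    unfold HA
    have : {x : Fin d → ℕ | ∀ i, i ∉ (∅ : Finset (Fin d)) → x i = n i} = {n} := by
      ext x
      simp [funext_iff]
    rw [this, finsum_mem_singleton]
  rwa [e] at h


/-- the Walsh series whose coefficients are the Fourier–Walsh coefficients
of `τ_F` is a null-series realizing `F`: `a_𝟎 = 1`, and the series converges to `0` over
rectangles (hence over cubes and iteratedly in any order) at every `𝐠 ∉ F`; thus `F` is
an M-set for rectangular, cube and iterated convergence. -/
theorem statement14 (d : ℕ) (hd : 2 ≤ d) (τ : ℕ → (Fin d → ℕ) → ℂ)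
    (hτ : IsTauOf (Fpi (idPerm d)) τ) (a : (Fin d → ℕ) → ℂ)
    (ha : ∀ (n : Fin d → ℕ) (k : ℕ), (∀ l, n l < 2 ^ k) → a n = fourierCoeffAt τ n k) :
    a (fun _ => 0) = 1 ∧ (∃ n, a n ≠ 0) ∧
    (∀ g ∉ Fpi (idPerm d),
      ConvergesOverRectangles a g 0 ∧ ConvergesOverCubes a g 0 ∧
      ∀ l : List (Fin d), l.Nodup → (∀ j, j ∈ l) →
        IterConverges l (fun n => a n * (walshD n g : ℂ)) 0) ∧
    IsMSetRect (Fpi (idPerm d)) ∧ IsMSetCubes (Fpi (idPerm d)) ∧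
    (∀ l : List (Fin d), l.Nodup → (∀ j, j ∈ l) → IsMSetIter (Fpi (idPerm d)) l) := by
  have hd0 : 0 < d := by omega
  have h0 : a (fun _ => 0) = 1 := by
    rw [ha (fun _ => 0) 0 (by simp), fourierCoeffAt]
    have : boxLt (fun _ : Fin d => 2 ^ 0) = {fun _ => 0} := by
      ext n
      rw [mem_boxLt, Finset.mem_singleton, funext_iff]
      simp
    rw [this, Finset.sum_singleton, hτ.2.1]
    simp [walshValD, walshD, walsh_zero]
  have hne : ∃ n, a n ≠ 0 := ⟨fun _ => 0, by rw [h0]; exact one_ne_zero⟩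
  have hrect : ∀ g ∉ Fpi (idPerm d), ConvergesOverRectangles a g 0 :=
    fun g hg => rect_conv hd0 τ hτ a ha g hg
  have hcube : ∀ g ∉ Fpi (idPerm d), ConvergesOverCubes a g 0 := by
    intro g hg
    refine (hrect g hg).comp ?_
    rw [tendsto_atTop]
    intro b
    filter_upwards [eventually_ge_atTop (∑ i, b i)] with T hT
    intro i
    exact (Finset.single_le_sum (fun _ _ => Nat.zero_le _) (Finset.mem_univ i)).trans hT
  have hiter : ∀ g ∉ Fpi (idPerm d), ∀ l : List (Fin d), l.Nodup → (∀ j, j ∈ l) →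
        IterConverges l (fun n => a n * (walshD n g : ℂ)) 0 := by
    intro g hg l hnd hl
    apply iter_conv hd0 _ _ (hrect g hg) l hnd hl
    intro x hx
    exact supp_ratio hd0 τ hτ a ha x (left_ne_zero_of_mul hx)
  exact ⟨h0, hne, fun g hg => ⟨hrect g hg, hcube g hg, hiter g hg⟩, ⟨a, hne, hrect⟩,
    ⟨a, hne, hcube⟩, fun l hnd hl => ⟨a, hne, fun g hg => hiter g hg l hnd hl⟩⟩
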